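/- Soundness of λ_CLC: if Γ ⊢ t₁ ≡ t₂ is derivable in the equational theory of λ_CLC (for well-formed terms t₁, t₂ of the same sort in context Γ), then ⟦t₁⟧ = ⟦t₂⟧ in every λ_CLC-structure. -/

import Mathlib

universe u

/-- A renaming from `m` to `n` is a function `Fin m → Fin n`. -/
abbrev Ren (m n : ℕ) : Type := Fin m → Fin n

/-- The identity renaming. -/
def idRen (n : ℕ) : Ren n n := fun i => i

/-- Block sum of renamings. -/
def bsum {m₁ n₁ m₂ n₂ : ℕ} (r : Ren m₁ n₁) (r' : Ren m₂ n₂) : Ren (m₁ + m₂) (n₁ + n₂) :=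
  fun i => Fin.addCases (motive := fun _ => Fin (n₁ + n₂))
    (fun a => Fin.castAdd n₂ (r a)) (fun b => Fin.natAdd n₁ (r' b)) i

/-- The block swap `σ_{m,n} : m+n → n+m`. -/
def swapRen (m n : ℕ) : Ren (m + n) (n + m) :=
  fun i => Fin.addCases (motive := fun _ => Fin (n + m))
    (fun a => Fin.natAdd n a) (fun b => Fin.castAdd m b) i

/-- The copy renaming `Δ_n : n+n → n`, sending both copies of `i` to `i`. -/
def copyRen (n : ℕ) : Ren (n + n) n :=
  fun i => Fin.addCases (motive := fun _ => Fin n) (fun a => a) (fun b => b) i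

/-- The discard renaming `!_n : 0 → n` (the empty function). -/
def discardRen (n : ℕ) : Ren 0 n := fun i => i.elim0

/-- Cast along an equality of arities. -/
def acast {C : ℕ → Type u} {m n : ℕ} (h : m = n) : C m → C n := fun x => h ▸ x

/-- Cast along equalities of both arities. -/
def hcast {H : ℕ → ℕ → Type u} {a a' b b' : ℕ} (h₁ : a = a') (h₂ : b = b') : H a b → H a' b' :=
  fun f => h₂ ▸ h₁ ▸ f

/-- A preoperad: a family of sets `C n` with an identity `one ∈ C 1` and single
substitution `f{n₁ ⊣ g ⊢ n₂}`, satisfying unit and associativity laws. -/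
structure Preoperad where
  C : ℕ → Type
  one : C 1
  subst : ∀ (n₁ n₂ : ℕ) {m : ℕ}, C (n₁ + 1 + n₂) → C m → C (n₁ + m + n₂)
  left_unit : ∀ {m : ℕ} (g : C m), subst 0 0 one g = acast (C := C) (by omega) g
  right_unit : ∀ {n₁ n₂ : ℕ} (f : C (n₁ + 1 + n₂)), subst n₁ n₂ f one = f
  assoc : ∀ {m₁ m₂ n₁ n₂ k : ℕ} (f : C (m₁ + 1 + m₂)) (g : C (n₁ + 1 + n₂)) (h : C k),
    subst (m₁ + n₁) (n₂ + m₂) (acast (C := C) (by omega) (subst m₁ m₂ f g)) h =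
      acast (C := C) (by omega) (subst m₁ m₂ f (subst n₁ n₂ g h))

/-- Two elements `g₁ ∈ C k₁`, `g₂ ∈ C k₂` of a preoperad commute when substituting them
into the two distinguished inputs of any morphism in either order yields the same
result (in both orientations). -/
def Preoperad.Commute (P : Preoperad) {k₁ k₂ : ℕ} (g₁ : P.C k₁) (g₂ : P.C k₂) : Prop :=
  ∀ (m₁ m m₂ : ℕ) (f : P.C (m₁ + 1 + m + 1 + m₂)),
    (P.subst (m₁ + k₁ + m) m₂
        (acast (C := P.C) (by omega)
          (P.subst m₁ (m + 1 + m₂) (acast (C := P.C) (by omega) f) g₁)) g₂ =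
      acast (C := P.C) (by omega)
        (P.subst m₁ (m + k₂ + m₂)
          (acast (C := P.C) (by omega) (P.subst (m₁ + 1 + m) m₂ f g₂)) g₁)) ∧
    (P.subst (m₁ + k₂ + m) m₂
        (acast (C := P.C) (by omega)
          (P.subst m₁ (m + 1 + m₂) (acast (C := P.C) (by omega) f) g₂)) g₁ =
      acast (C := P.C) (by omega)
        (P.subst m₁ (m + k₁ + m₂)
          (acast (C := P.C) (by omega) (P.subst (m₁ + 1 + m) m₂ f g₁)) g₂))

/-- An element is central if it commutes with every element. -/
def Preoperad.Central (P : Preoperad) {k : ℕ} (g : P.C k) : Prop :=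
  ∀ {k' : ℕ} (g' : P.C k'), P.Commute g g'

/-- A `Ren`-cartesian preoperad: a preoperad equipped with reindexing `f[r]` along all
renamings, functorially, and satisfying the renaming–substitution interchange law. -/
structure RenPreoperad extends Preoperad where
  ren : ∀ {m n : ℕ}, C m → Ren m n → C n
  ren_id : ∀ {m : ℕ} (f : C m), ren f (idRen m) = f
  ren_comp : ∀ {m n k : ℕ} (f : C m) (r₁ : Ren m n) (r₂ : Ren n k),
    ren f (r₂ ∘ r₁) = ren (ren f r₁) r₂
  ren_subst : ∀ {n₁ n₂ k m₁ m₂ m : ℕ} (f : C (n₁ + 1 + n₂)) (g : C k)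
      (r₁ : Ren n₁ m₁) (r : Ren k m) (r₂ : Ren n₂ m₂),
    ren (subst n₁ n₂ f g) (bsum (bsum r₁ r) r₂) =
      subst m₁ m₂ (ren f (bsum (bsum r₁ (idRen 1)) r₂)) (ren g r)

/-- A symmetric `Ren`-cartesian preoperad: transpositions are natural with respect to
single substitution, in both orientations. -/
structure SymRenPreoperad extends RenPreoperad where
  sym_nat₁ : ∀ {m₁ m₂ n : ℕ} (f : C (m₁ + 2 + m₂)) (g : C n),
    subst m₁ (1 + m₂)
        (acast (C := C) (by omega)
          (ren f (bsum (bsum (idRen m₁) (swapRen 1 1)) (idRen m₂)))) g =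
      acast (C := C) (by omega)
        (ren (acast (C := C) (by omega) (subst (m₁ + 1) m₂ f g))
          (bsum (bsum (idRen m₁) (swapRen 1 n)) (idRen m₂)))
  sym_nat₂ : ∀ {m₁ m₂ n : ℕ} (f : C (m₁ + 2 + m₂)) (g : C n),
    subst (m₁ + 1) m₂
        (ren f ((bsum (bsum (idRen m₁) (swapRen 1 1)) (idRen m₂) :
          Ren (m₁ + (1 + 1) + m₂) (m₁ + (1 + 1) + m₂)))) g =
      acast (C := C) (by omega)
        (ren (acast (C := C) (by omega) (subst m₁ (1 + m₂) (acast (C := C) (by omega) f) g))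
          (bsum (bsum (idRen m₁) (swapRen n 1)) (idRen m₂)))

/-- A cartesian operad: a `Ren`-cartesian symmetric preoperad in which every element is
central and in which discard and copy are natural with respect to single substitution. -/
structure CartOperad extends SymRenPreoperad where
  central : ∀ {k : ℕ} (g : C k), toPreoperad.Central g
  discard_nat : ∀ {m₁ m₂ n : ℕ} (f : C (m₁ + 0 + m₂)) (g : C n),
    subst m₁ m₂
        (ren f ((bsum (bsum (idRen m₁) (discardRen 1)) (idRen m₂) :
          Ren (m₁ + 0 + m₂) (m₁ + 1 + m₂)))) g =
      ren f ((bsum (bsum (idRen m₁) (discardRen n)) (idRen m₂) :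
        Ren (m₁ + 0 + m₂) (m₁ + n + m₂)))
  copy_nat : ∀ {m₁ m₂ n : ℕ} (f : C (m₁ + 2 + m₂)) (g : C n),
    subst m₁ m₂
        (ren f ((bsum (bsum (idRen m₁) (copyRen 1)) (idRen m₂) :
          Ren (m₁ + (1 + 1) + m₂) (m₁ + 1 + m₂)))) g =
      ren (acast (C := C) (by omega)
            (subst m₁ (n + m₂) (acast (C := C) (by omega) (subst (m₁ + 1) m₂ f g)) g))
        ((bsum (bsum (idRen m₁) (copyRen n)) (idRen m₂) :
          Ren (m₁ + (n + n) + m₂) (m₁ + n + m₂)))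

/-- A cartesian preoperad functor: preserves the identity, single substitution and
reindexing. -/
structure RenPreoperadHom (P Q : RenPreoperad) where
  map : ∀ {n : ℕ}, P.C n → Q.C n
  map_one : map P.one = Q.one
  map_subst : ∀ {n₁ n₂ m : ℕ} (f : P.C (n₁ + 1 + n₂)) (g : P.C m),
    map (P.subst n₁ n₂ f g) = Q.subst n₁ n₂ (map f) (map g)
  map_ren : ∀ {m n : ℕ} (f : P.C m) (r : Ren m n), map (P.ren f r) = Q.ren (map f) r

/-- Composition of cartesian preoperad functors. -/
def RenPreoperadHom.comp {P Q R : RenPreoperad} (F : RenPreoperadHom P Q)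
    (G : RenPreoperadHom Q R) : RenPreoperadHom P R where
  map f := G.map (F.map f)
  map_one := by show G.map (F.map P.one) = _; rw [F.map_one, G.map_one]
  map_subst f g := by
    show G.map (F.map _) = _
    rw [F.map_subst, G.map_subst]
  map_ren f r := by
    show G.map (F.map _) = _
    rw [F.map_ren, G.map_ren]

/-- A Freyd operad: a cartesian operad `V` of values, a symmetric `Ren`-cartesian
preoperad `C` of computations, and a cartesian preoperad functor `I : V → C` whose image
consists of central elements (and hence forms a cartesian operad). -/
structure FreydOperad where
  V : CartOperad
  C : SymRenPreoperad
  I : RenPreoperadHom V.toRenPreoperad C.toRenPreoperad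
  I_central : ∀ {n : ℕ} (v : V.C n), C.toPreoperad.Central (I.map v)

/-- A Freyd operad functor: a pair of cartesian preoperad functors commuting with the
functors `I`. -/
structure FreydOperadHom (O₁ O₂ : FreydOperad) where
  mapV : RenPreoperadHom O₁.V.toRenPreoperad O₂.V.toRenPreoperad
  mapC : RenPreoperadHom O₁.C.toRenPreoperad O₂.C.toRenPreoperad
  square : ∀ {n : ℕ} (v : O₁.V.C n), mapC.map (O₁.I.map v) = O₂.I.map (mapV.map v)

/-- Composition of Freyd operad functors. -/
def FreydOperadHom.comp {O₁ O₂ O₃ : FreydOperad} (F : FreydOperadHom O₁ O₂)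
    (G : FreydOperadHom O₂ O₃) : FreydOperadHom O₁ O₃ where
  mapV := F.mapV.comp G.mapV
  mapC := F.mapC.comp G.mapC
  square v := by
    show G.mapC.map (F.mapC.map _) = _
    rw [F.square, G.square]; rfl

/-- A weakly closed Freyd operad: abstraction `λₙ : C(n+1) → V(n)` and application
`@ ∈ C 2` satisfying the β-law and compatibility of abstraction with substitution. -/
structure WCFreydOperad extends FreydOperad where
  abs : ∀ {n : ℕ}, C.C (n + 1) → V.C n
  app : C.C 2
  beta : ∀ {n : ℕ} (f : C.C (n + 1)),
    C.subst 0 1 app (I.map (abs f)) = acast (C := C.C) (by omega) f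
  abs_subst : ∀ {m₁ m₂ k : ℕ} (f : C.C (m₁ + 1 + (m₂ + 1))) (v : V.C k),
    abs (acast (C := C.C) (by omega) (C.subst m₁ (m₂ + 1) f (I.map v))) =
      V.subst m₁ m₂ (abs (acast (C := C.C) (by omega) f)) v

/-- A signature: function symbols and procedure symbols, each with an arity. -/
structure Sig where
  Func : Type
  fArity : Func → ℕ
  Proc : Type
  pArity : Proc → ℕ

mutual
/-- Values of λ_CLC, well formed in a context `x₁, …, xₙ` (de Bruijn presentation):
variables, function-symbol applications, and λ-abstractions. -/
inductive DVal (Sg : Sig) : ℕ → Type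
  | var {n : ℕ} (i : Fin n) : DVal Sg n
  | func {n : ℕ} (f : Sg.Func) (args : Fin (Sg.fArity f) → DVal Sg n) : DVal Sg n
  | lam {n : ℕ} (M : DCmp Sg (n + 1)) : DVal Sg n

/-- Computations of λ_CLC, well formed in a context `x₁, …, xₙ`: returned values,
sequencing `let x = M₁ in M₂`, procedure-symbol applications, and applications. -/
inductive DCmp (Sg : Sig) : ℕ → Type
  | ret {n : ℕ} (W : DVal Sg n) : DCmp Sg n
  | letin {n : ℕ} (M₁ : DCmp Sg n) (M₂ : DCmp Sg (n + 1)) : DCmp Sg n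
  | proc {n : ℕ} (p : Sg.Proc) (args : Fin (Sg.pArity p) → DVal Sg n) : DCmp Sg n
  | app {n : ℕ} (V₁ V₂ : DVal Sg n) : DCmp Sg n
end

/-- Lift a renaming under a binder. -/
def liftRen {m n : ℕ} (r : Fin m → Fin n) : Fin (m + 1) → Fin (n + 1) :=
  fun i => Fin.lastCases (Fin.last n) (fun j => (r j).castSucc) i

mutual
/-- Rename the free variables of a value. -/
def renameV {Sg : Sig} : ∀ {m n : ℕ}, DVal Sg m → (Fin m → Fin n) → DVal Sg n
  | _, _, .var i, r => .var (r i)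
  | _, _, .func f args, r => .func f (fun i => renameV (args i) r)
  | _, _, .lam M, r => .lam (renameC M (liftRen r))

/-- Rename the free variables of a computation. -/
def renameC {Sg : Sig} : ∀ {m n : ℕ}, DCmp Sg m → (Fin m → Fin n) → DCmp Sg n
  | _, _, .ret W, r => .ret (renameV W r)
  | _, _, .letin M₁ M₂, r => .letin (renameC M₁ r) (renameC M₂ (liftRen r))
  | _, _, .proc p args, r => .proc p (fun i => renameV (args i) r)
  | _, _, .app V₁ V₂, r => .app (renameV V₁ r) (renameV V₂ r)
end

/-- Lift a simultaneous substitution under a binder. -/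
def liftSub {Sg : Sig} {m n : ℕ} (σ : Fin m → DVal Sg n) : Fin (m + 1) → DVal Sg (n + 1) :=
  fun i => Fin.lastCases (.var (Fin.last n)) (fun j => renameV (σ j) Fin.castSucc) i

mutual
/-- Capture-avoiding simultaneous substitution of values for the free variables of a
value. -/
def substV {Sg : Sig} : ∀ {m n : ℕ}, DVal Sg m → (Fin m → DVal Sg n) → DVal Sg n
  | _, _, .var i, σ => σ i
  | _, _, .func f args, σ => .func f (fun i => substV (args i) σ)
  | _, _, .lam M, σ => .lam (substC M (liftSub σ))

/-- Capture-avoiding simultaneous substitution of values for the free variables of a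
computation. -/
def substC {Sg : Sig} : ∀ {m n : ℕ}, DCmp Sg m → (Fin m → DVal Sg n) → DCmp Sg n
  | _, _, .ret W, σ => .ret (substV W σ)
  | _, _, .letin M₁ M₂, σ => .letin (substC M₁ σ) (substC M₂ (liftSub σ))
  | _, _, .proc p args, σ => .proc p (fun i => substV (args i) σ)
  | _, _, .app V₁ V₂, σ => .app (substV V₁ σ) (substV V₂ σ)
end

/-- Length of the concatenation of a family of contexts with sizes `k 0, …, k (n-1)`. -/
def finSum : ∀ {n : ℕ}, (Fin n → ℕ) → ℕ
  | 0, _ => 0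
  | n + 1, k => finSum (fun i => k i.castSucc) + k (Fin.last n)

/-- The embedding of the `i`-th block into the concatenation of blocks of sizes `k`. -/
def blockInj : ∀ {n : ℕ} (k : Fin n → ℕ) (i : Fin n), Fin (k i) → Fin (finSum k)
  | n + 1, k, i =>
      Fin.lastCases (motive := fun i => Fin (k i) → Fin (finSum k))
        (fun a => Fin.natAdd (finSum fun j => k j.castSucc) a)
        (fun j a => Fin.castAdd (k (Fin.last n)) (blockInj (fun j => k j.castSucc) j a))
        i

/-- Case analysis on the concatenation of blocks of sizes `k`. -/
def finSumCases : ∀ {n : ℕ} (k : Fin n → ℕ) {α : Sort _},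
    (∀ i, Fin (k i) → α) → Fin (finSum k) → α
  | 0, _, _, _, j => j.elim0
  | n + 1, k, _, h, j =>
      Fin.addCases (fun a => finSumCases (fun i => k i.castSucc) (fun i => h i.castSucc) a)
        (fun b => h (Fin.last n) b) j

/-- Iterated (parallel) substitution, with a fixed trailing block of size `t`. -/
def Preoperad.psubAux (P : Preoperad) :
    ∀ {n : ℕ} (k : Fin n → ℕ) (t : ℕ), P.C (n + t) → (∀ i, P.C (k i)) → P.C (finSum k + t)
  | 0, _, _, f, _ => f
  | n + 1, k, t, f, g =>
      acast (C := P.C)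
        (by simp only [finSum]; omega)
        (P.psubAux (fun i => k i.castSucc) (k (Fin.last n) + t)
          (acast (C := P.C) (by omega) (P.subst n t f (g (Fin.last n))))
          (fun i => g i.castSucc))

/-- Parallel substitution of the elements `g i ∈ C (k i)` into the `n` inputs of
`f ∈ C n` (performed sequentially; when the `g i` are central the order is
irrelevant). -/
def Preoperad.psub (P : Preoperad) {n : ℕ} (k : Fin n → ℕ) (f : P.C n)
    (g : ∀ i, P.C (k i)) : P.C (finSum k) :=
  P.psubAux k 0 f g

/-- A λ_CLC-structure over a signature: a weakly closed Freyd operad together with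
interpretations of all function and procedure symbols. -/
structure CLCStructure (Sg : Sig) where
  O : WCFreydOperad
  Ff : ∀ f : Sg.Func, O.V.C (Sg.fArity f)
  Pp : ∀ p : Sg.Proc, O.C.C (Sg.pArity p)

mutual
/-- Interpretation of values in a λ_CLC-structure: a variable is the identity reindexed
along discards, function applications are parallel substitutions into the interpretation
of the symbol (followed by contraction of the shared context), and abstractions are
interpreted by the weak closure. -/
def interpV {Sg : Sig} (S : CLCStructure Sg) : ∀ {n : ℕ}, DVal Sg n → S.O.V.C n
  | n, .var i => S.O.V.ren S.O.V.one (fun _ => i)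
  | n, .func f args =>
      S.O.V.ren
        (S.O.V.toPreoperad.psub (fun _ => n) (S.Ff f) (fun i => interpV S (args i)))
        (finSumCases (fun _ => n) (fun _ a => a))
  | _, .lam M => S.O.abs (interpC S M)

/-- Interpretation of computations in a λ_CLC-structure: `return` is interpreted by `I`,
`let` by single substitution in `C` (followed by contraction of the shared context),
procedure applications like function applications, and application via the weak
closure's application element. -/
def interpC {Sg : Sig} (S : CLCStructure Sg) : ∀ {n : ℕ}, DCmp Sg n → S.O.C.C n
  | _, .ret W => S.O.I.map (interpV S W)
  | n, .letin M₁ M₂ =>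
      S.O.C.ren (S.O.C.subst n 0 (interpC S M₂) (interpC S M₁)) (copyRen n)
  | n, .proc p args =>
      S.O.C.ren
        (S.O.C.toPreoperad.psub (fun _ => n) (S.Pp p)
          (fun i => S.O.I.map (interpV S (args i))))
        (finSumCases (fun _ => n) (fun _ a => a))
  | n, .app V₁ V₂ =>
      S.O.C.ren
        (S.O.C.toPreoperad.psub (fun _ : Fin 2 => n) S.O.app
          (fun i => S.O.I.map (Fin.cases (interpV S V₁) (fun _ => interpV S V₂) i)))
        (finSumCases (fun _ : Fin 2 => n) (fun _ a => a))
end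

/-- The single substitution `[x := W]` of a value for the last variable. -/
def sub1 {Sg : Sig} {n : ℕ} (W : DVal Sg n) : Fin (n + 1) → DVal Sg n :=
  fun i => Fin.lastCases W (fun j => .var j) i

/-- Weakening inserting a fresh variable just below the last one. -/
def midWeak (n : ℕ) : Fin (n + 1) → Fin (n + 2) :=
  fun i => Fin.lastCases (Fin.last (n + 1)) (fun j => j.castSucc.castSucc) i

mutual
/-- The equational theory of λ_CLC on values: the least congruence containing the
axioms (lunit), (runit), (assoc) and (beta). -/
inductive EqV (Sg : Sig) : {n : ℕ} → DVal Sg n → DVal Sg n → Prop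
  | refl {n : ℕ} (V : DVal Sg n) : EqV Sg V V
  | symm {n : ℕ} {V₁ V₂ : DVal Sg n} : EqV Sg V₁ V₂ → EqV Sg V₂ V₁
  | trans {n : ℕ} {V₁ V₂ V₃ : DVal Sg n} : EqV Sg V₁ V₂ → EqV Sg V₂ V₃ → EqV Sg V₁ V₃
  | func {n : ℕ} (f : Sg.Func) {args args' : Fin (Sg.fArity f) → DVal Sg n} :
      (∀ i, EqV Sg (args i) (args' i)) → EqV Sg (.func f args) (.func f args')
  | lam {n : ℕ} {M M' : DCmp Sg (n + 1)} : EqC Sg M M' → EqV Sg (.lam M) (.lam M')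

/-- The equational theory of λ_CLC on computations. -/
inductive EqC (Sg : Sig) : {n : ℕ} → DCmp Sg n → DCmp Sg n → Prop
  | refl {n : ℕ} (M : DCmp Sg n) : EqC Sg M M
  | symm {n : ℕ} {M₁ M₂ : DCmp Sg n} : EqC Sg M₁ M₂ → EqC Sg M₂ M₁
  | trans {n : ℕ} {M₁ M₂ M₃ : DCmp Sg n} : EqC Sg M₁ M₂ → EqC Sg M₂ M₃ → EqC Sg M₁ M₃
  | ret {n : ℕ} {W W' : DVal Sg n} : EqV Sg W W' → EqC Sg (.ret W) (.ret W')
  | letin {n : ℕ} {M₁ M₁' : DCmp Sg n} {M₂ M₂' : DCmp Sg (n + 1)} :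
      EqC Sg M₁ M₁' → EqC Sg M₂ M₂' → EqC Sg (.letin M₁ M₂) (.letin M₁' M₂')
  | proc {n : ℕ} (p : Sg.Proc) {args args' : Fin (Sg.pArity p) → DVal Sg n} :
      (∀ i, EqV Sg (args i) (args' i)) → EqC Sg (.proc p args) (.proc p args')
  | app {n : ℕ} {V₁ V₁' V₂ V₂' : DVal Sg n} :
      EqV Sg V₁ V₁' → EqV Sg V₂ V₂' → EqC Sg (.app V₁ V₂) (.app V₁' V₂')
  /-- (lunit) `let x = return W in M ≡ M[x := W]` -/
  | lunit {n : ℕ} (W : DVal Sg n) (M : DCmp Sg (n + 1)) :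
      EqC Sg (.letin (.ret W) M) (substC M (sub1 W))
  /-- (runit) `let x = M in return x ≡ M` -/
  | runit {n : ℕ} (M : DCmp Sg n) :
      EqC Sg (.letin M (.ret (.var (Fin.last n)))) M
  /-- (assoc) `let y = (let x = M₁ in M₂) in M ≡ let x = M₁ in (let y = M₂ in M)` -/
  | assoc {n : ℕ} (M₁ : DCmp Sg n) (M₂ : DCmp Sg (n + 1)) (M : DCmp Sg (n + 1)) :
      EqC Sg (.letin (.letin M₁ M₂) M)
        (.letin M₁ (.letin M₂ (renameC M (midWeak n))))
  /-- (beta) `(λx.M) W ≡ M[x := W]` -/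
  | beta {n : ℕ} (M : DCmp Sg (n + 1)) (W : DVal Sg n) :
      EqC Sg (.app (.lam M) W) (substC M (sub1 W))
end

/-- Embedding of the left block `n₁` into `n₁ + m + n₂`. -/
def embL (n₁ m n₂ : ℕ) : Fin n₁ → Fin (n₁ + m + n₂) :=
  fun j => Fin.castAdd n₂ (Fin.castAdd m j)

/-- Embedding of the middle block `m` into `n₁ + m + n₂`. -/
def embM (n₁ m n₂ : ℕ) : Fin m → Fin (n₁ + m + n₂) :=
  fun a => Fin.castAdd n₂ (Fin.natAdd n₁ a)

/-- Embedding of the right block `n₂` into `n₁ + m + n₂`. -/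
def embR (n₁ m n₂ : ℕ) : Fin n₂ → Fin (n₁ + m + n₂) :=
  fun z => Fin.natAdd (n₁ + m) z

/-- The simultaneous substitution replacing the distinguished middle variable of
`n₁ + 1 + n₂` by `V₂` (placed in the middle block) and renaming the other variables
accordingly. -/
def midSubst {Sg : Sig} (n₁ n₂ : ℕ) {m : ℕ} (V₂ : DVal Sg m) :
    Fin (n₁ + 1 + n₂) → DVal Sg (n₁ + m + n₂) :=
  fun i =>
    Fin.addCases (motive := fun _ => DVal Sg (n₁ + m + n₂))
      (fun j : Fin (n₁ + 1) =>
        Fin.lastCases (renameV V₂ (embM n₁ m n₂)) (fun j' => .var (embL n₁ m n₂ j')) j)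
      (fun z : Fin n₂ => .var (embR n₁ m n₂ z)) i

/-- Single substitution of a value into the distinguished middle variable of a value. -/
def tsubV {Sg : Sig} (n₁ n₂ : ℕ) {m : ℕ} (V₁ : DVal Sg (n₁ + 1 + n₂)) (V₂ : DVal Sg m) :
    DVal Sg (n₁ + m + n₂) :=
  substV V₁ (midSubst n₁ n₂ V₂)

/-- Renaming sending the distinguished middle variable of `n₁ + 1 + n₂` to the last
variable of `(n₁ + m + n₂) + 1` and the remaining variables to the corresponding
blocks. -/
def midToLast (n₁ n₂ m : ℕ) : Fin (n₁ + 1 + n₂) → Fin (n₁ + m + n₂ + 1) :=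
  fun i =>
    Fin.addCases (motive := fun _ => Fin (n₁ + m + n₂ + 1))
      (fun j : Fin (n₁ + 1) =>
        Fin.lastCases (Fin.last (n₁ + m + n₂)) (fun j' => (embL n₁ m n₂ j').castSucc) j)
      (fun z : Fin n₂ => (embR n₁ m n₂ z).castSucc) i

/-- Single substitution of a computation into the distinguished middle variable of a
computation, given by sequencing: `let y = M₂ in M₁`. -/
def tletC {Sg : Sig} (n₁ n₂ : ℕ) {m : ℕ} (M₁ : DCmp Sg (n₁ + 1 + n₂)) (M₂ : DCmp Sg m) :
    DCmp Sg (n₁ + m + n₂) :=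
  .letin (renameC M₂ (embM n₁ m n₂)) (renameC M₁ (midToLast n₁ n₂ m))

/-- `S` is a term model of λ_CLC: its carriers are equivalence classes of well-formed
terms modulo provable equality, with single substitution given by value substitution
(resp. `let`-sequencing), reindexing by syntactic renaming, `I` by `return`, abstraction
by `λ`, application by the class of `x₁ x₂`, and symbol interpretations by their
canonical terms. -/
def IsTermModel {Sg : Sig} (S : CLCStructure Sg)
    (eV : ∀ n : ℕ, S.O.V.C n ≃ Quot (@EqV Sg n)) (eC : ∀ n : ℕ, S.O.C.C n ≃ Quot (@EqC Sg n)) :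
    Prop :=
  (eV 1 S.O.V.one = Quot.mk _ (.var 0)) ∧
  (eC 1 S.O.C.one = Quot.mk _ (.ret (.var 0))) ∧
  (∀ {n₁ n₂ m : ℕ} (V₁ : DVal Sg (n₁ + 1 + n₂)) (V₂ : DVal Sg m),
    eV _ (S.O.V.subst n₁ n₂ ((eV _).symm (Quot.mk _ V₁)) ((eV _).symm (Quot.mk _ V₂))) =
      Quot.mk _ (tsubV n₁ n₂ V₁ V₂)) ∧
  (∀ {n₁ n₂ m : ℕ} (M₁ : DCmp Sg (n₁ + 1 + n₂)) (M₂ : DCmp Sg m),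
    eC _ (S.O.C.subst n₁ n₂ ((eC _).symm (Quot.mk _ M₁)) ((eC _).symm (Quot.mk _ M₂))) =
      Quot.mk _ (tletC n₁ n₂ M₁ M₂)) ∧
  (∀ {m n : ℕ} (V : DVal Sg m) (r : Ren m n),
    eV _ (S.O.V.ren ((eV _).symm (Quot.mk _ V)) r) = Quot.mk _ (renameV V r)) ∧
  (∀ {m n : ℕ} (M : DCmp Sg m) (r : Ren m n),
    eC _ (S.O.C.ren ((eC _).symm (Quot.mk _ M)) r) = Quot.mk _ (renameC M r)) ∧
  (∀ {n : ℕ} (V : DVal Sg n),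
    eC _ (S.O.I.map ((eV _).symm (Quot.mk _ V))) = Quot.mk _ (.ret V)) ∧
  (∀ {n : ℕ} (M : DCmp Sg (n + 1)),
    eV _ (S.O.abs ((eC _).symm (Quot.mk _ M))) = Quot.mk _ (.lam M)) ∧
  (eC 2 S.O.app = Quot.mk _ (.app (.var 0) (.var 1))) ∧
  (∀ f : Sg.Func, eV _ (S.Ff f) = Quot.mk _ (.func f (fun i => .var i))) ∧
  (∀ p : Sg.Proc, eC _ (S.Pp p) = Quot.mk _ (.proc p (fun i => .var i)))

/-- A morphism of λ_CLC-structures: a pair of cartesian preoperad functors commuting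
with the functors `I`, preserving abstraction and application, and preserving the
interpretations of all function and procedure symbols. -/
structure CLCHom {Sg : Sig} (S₁ S₂ : CLCStructure Sg) where
  mapV : RenPreoperadHom S₁.O.V.toRenPreoperad S₂.O.V.toRenPreoperad
  mapC : RenPreoperadHom S₁.O.C.toRenPreoperad S₂.O.C.toRenPreoperad
  squareI : ∀ {n : ℕ} (v : S₁.O.V.C n), mapC.map (S₁.O.I.map v) = S₂.O.I.map (mapV.map v)
  mapAbs : ∀ {n : ℕ} (f : S₁.O.C.C (n + 1)), mapV.map (S₁.O.abs f) = S₂.O.abs (mapC.map f)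
  mapApp : mapC.map S₁.O.app = S₂.O.app
  mapFf : ∀ f : Sg.Func, mapV.map (S₁.Ff f) = S₂.Ff f
  mapPp : ∀ p : Sg.Proc, mapC.map (S₁.Pp p) = S₂.Pp p

section Renamings

theorem bsum_val {m₁ n₁ m₂ n₂ : ℕ} (r : Ren m₁ n₁) (r' : Ren m₂ n₂) (i : Fin (m₁ + m₂)) :
    (bsum r r' i).val = if h : i.val < m₁ then (r ⟨i.val, h⟩).val
      else n₁ + (r' ⟨i.val - m₁, by omega⟩).val := by
  refine Fin.addCases (fun a => ?_) (fun b => ?_) i <;> simp [bsum]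

theorem swapRen_val (m n : ℕ) (i : Fin (m + n)) :
    (swapRen m n i).val = if i.val < m then n + i.val else i.val - m := by
  refine Fin.addCases (fun a => ?_) (fun b => ?_) i <;> simp [swapRen]

theorem copyRen_val (n : ℕ) (i : Fin (n + n)) :
    (copyRen n i).val = if i.val < n then i.val else i.val - n := by
  refine Fin.addCases (fun a => ?_) (fun b => ?_) i
  · simp [copyRen]
  · simp only [copyRen, Fin.addCases_right]
    simp

theorem liftRen_val {m n : ℕ} (r : Ren m n) (i : Fin (m + 1)) :
    (liftRen r i).val = if h : i.val < m then (r ⟨i.val, h⟩).val else n := by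
  refine Fin.lastCases ?_ (fun a => ?_) i <;> simp [liftRen]

/-- The renaming exchanging the last two variables. -/
def swapLast (n : ℕ) : Ren (n + 2) (n + 2) := fun i =>
  ⟨if i.val = n then n + 1 else if i.val = n + 1 then n else i.val, by split_ifs <;> omega⟩

/-- The renaming identifying the last two variables. -/
def mergeLast (n : ℕ) : Ren (n + 2) (n + 1) := fun i => ⟨min i.val n, by omega⟩

end Renamings

theorem acast_eq_ren (P : RenPreoperad) {m n : ℕ} (h : m = n) (x : P.C m) :
    acast (C := P.C) h x = P.ren x (Fin.cast h) := by
  subst h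
  exact (P.ren_id x).symm

/-- Substitution for the last variable followed by contraction of the shared context. -/
def RenPreoperad.bind (P : RenPreoperad) {n : ℕ} (f : P.C (n + 1)) (g : P.C n) : P.C n :=
  P.ren (P.subst n 0 f g) (copyRen n)

theorem RenPreoperad.ren_ren (P : RenPreoperad) {m n k : ℕ} (f : P.C m) (r₁ : Ren m n)
    (r₂ : Ren n k) : P.ren (P.ren f r₁) r₂ = P.ren f (fun i => r₂ (r₁ i)) :=
  (P.ren_comp f r₁ r₂).symm

theorem RenPreoperad.ren_of_forall_eq (P : RenPreoperad) {n : ℕ} (f : P.C n) (r : Ren n n)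
    (h : ∀ i, (r i).val = i.val) : P.ren f r = f := by
  have : r = idRen n := funext fun i => Fin.ext (h i)
  rw [this, P.ren_id]

theorem RenPreoperad.ren_congr (P : RenPreoperad) {m n : ℕ} (f : P.C m) {r r' : Ren m n}
    (h : ∀ i, (r i).val = (r' i).val) : P.ren f r = P.ren f r' := by
  have : r = r' := funext fun i => Fin.ext (h i)
  rw [this]

theorem RenPreoperad.ren_subst_zero_eq_bind (P : RenPreoperad) {n k N : ℕ} (f : P.C (n + 1))
    (g : P.C k) (r : Ren (n + k) N) (r' : Ren (n + 1) (N + 1)) (s : Ren k N)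
    (hl : ∀ (i : ℕ) (h : i < n), (r' ⟨i, by omega⟩).val = (r ⟨i, by omega⟩).val)
    (hm : (r' ⟨n, by omega⟩).val = N)
    (hs : ∀ (i : ℕ) (h : i < k), (s ⟨i, h⟩).val = (r ⟨n + i, by omega⟩).val) :
    P.ren (P.subst n 0 f g) r = P.bind (P.ren f r') (P.ren g s) := by
  have hr' : r' = bsum (bsum (fun a => r (Fin.castAdd k a)) (idRen 1)) (idRen 0) := by
    funext ⟨i, hi⟩
    ext
    have h0 : i < n + 1 + 0 := hi
    simp only [bsum_val, h0, idRen, dite_true]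
    split_ifs with h
    · exact hl i h
    · obtain rfl : i = n := by omega
      rw [hm]; omega
  rw [hr']
  unfold RenPreoperad.bind
  erw [← P.ren_subst (n₂ := 0) (m₂ := 0) f g]
  rw [P.ren_ren]
  refine P.ren_congr _ fun ⟨i, hi⟩ => ?_
  have hi' : i < n + k := hi
  simp only [copyRen_val, bsum_val, hi', dite_true]
  by_cases h : i < n
  · simp [h]
  · have := hs (i - n) (by omega)
    simp only [h, dite_false, this]
    rw [if_neg (by omega), Nat.add_sub_cancel_left]
    congr 3
    omega

theorem SymRenPreoperad.ren_subst_eq_bind (P : SymRenPreoperad) (n₂ : ℕ) :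
    ∀ {n₁ k N : ℕ} (f : P.C (n₁ + 1 + n₂)) (g : P.C k) (r : Ren (n₁ + k + n₂) N)
      (r' : Ren (n₁ + 1 + n₂) (N + 1)) (s : Ren k N),
      (∀ (i : ℕ) (h : i < n₁), (r' ⟨i, by omega⟩).val = (r ⟨i, by omega⟩).val) →
      (r' ⟨n₁, by omega⟩).val = N →
      (∀ (i : ℕ) (h : i < n₂), (r' ⟨n₁ + 1 + i, by omega⟩).val =
        (r ⟨n₁ + k + i, by omega⟩).val) →
      (∀ (i : ℕ) (h : i < k), (s ⟨i, h⟩).val = (r ⟨n₁ + i, by omega⟩).val) →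
      P.ren (P.subst n₁ n₂ f g) r = P.bind (P.ren f r') (P.ren g s) := by
  induction n₂ with
  | zero =>
    intro n₁ k N f g r r' s hl hm _ hs
    exact P.ren_subst_zero_eq_bind f g r r' s hl hm hs
  | succ n₂ ih =>
    rw [Nat.add_comm n₂ 1]
    intro n₁ k N f g r r' s hl hm hr hs
    let t : Ren (n₁ + 1 + (1 + n₂)) (n₁ + 1 + 1 + n₂) := fun i =>
      ⟨if i.val = n₁ then n₁ + 1 else if i.val = n₁ + 1 then n₁ else i.val,
        by split_ifs <;> omega⟩
    let t' : Ren (n₁ + 1 + 1 + n₂) (n₁ + 1 + (1 + n₂)) := fun i =>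
      ⟨if i.val = n₁ then n₁ + 1 else if i.val = n₁ + 1 then n₁ else i.val,
        by split_ifs <;> omega⟩
    have ht : ∀ i, t' (t i) = i := by
      intro i; ext; simp only [t, t']; split_ifs <;> omega
    have hl' : ∀ x y, x.val < n₁ → y.val = x.val → (r' x).val = (r y).val := by
      rintro ⟨x, hx⟩ ⟨y, hy⟩ h rfl
      exact hl _ h
    have hm' : ∀ x, x.val = n₁ → (r' x).val = N := by
      rintro ⟨x, hx⟩ h
      obtain rfl : x = n₁ := h
      exact hm
    have hr'' : ∀ x y, n₁ < x.val → y.val + 1 = x.val + k → (r' x).val = (r y).val := by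
      rintro ⟨x, hx⟩ ⟨y, hy⟩ h h'
      dsimp only at h h'
      obtain ⟨z, rfl⟩ : ∃ z, x = n₁ + 1 + z := ⟨x - (n₁ + 1), by omega⟩
      obtain rfl : y = n₁ + k + z := by omega
      exact hr _ (by omega)
    have hs' : ∀ x y, y.val = n₁ + x.val → (s x).val = (r y).val := by
      rintro ⟨x, hx⟩ ⟨y, hy⟩ rfl
      exact hs _ _
    have key := P.sym_nat₁ (m₁ := n₁) (m₂ := n₂) (P.ren f t) g
    rw [acast_eq_ren P.toRenPreoperad, acast_eq_ren P.toRenPreoperad,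
      acast_eq_ren P.toRenPreoperad, P.ren_ren, P.ren_ren, P.ren_of_forall_eq, P.ren_ren,
      P.ren_ren] at key
    · rw [key, P.ren_ren, ih (n₁ := n₁ + 1) (P.ren f t) g _ (fun i => r' (t' i)) s, P.ren_ren]
      · simp only [ht]
      · intro i h
        by_cases hi : i = n₁
        · refine hr'' _ _ ?_ ?_ <;>
            simp only [t', Fin.val_cast, bsum_val, swapRen_val, idRen] <;> split_ifs <;> omega
        · refine hl' _ _ ?_ ?_
          · simp only [t']; split_ifs <;> omega
          · simp only [t', Fin.val_cast, bsum_val, swapRen_val, idRen]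
            split_ifs <;> omega
      · exact hm' _ (by simp [t'])
      · intro i h
        refine hr'' _ _ ?_ ?_
        · simp only [t']; split_ifs <;> omega
        · simp only [t', Fin.val_cast, bsum_val, swapRen_val, idRen]
          split_ifs <;> omega
      · intro i h
        refine hs' _ _ ?_
        simp only [Fin.val_cast, bsum_val, swapRen_val, idRen]
        split_ifs <;> omega
    · intro i
      simp only [t, Fin.val_cast, bsum_val, swapRen_val, idRen]
      split_ifs <;> omega

theorem RenPreoperad.ren_bind (P : RenPreoperad) {m n : ℕ} (f : P.C (m + 1)) (g : P.C m)
    (r : Ren m n) : P.ren (P.bind f g) r = P.bind (P.ren f (liftRen r)) (P.ren g r) := by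
  rw [RenPreoperad.bind, P.ren_ren]
  refine P.ren_subst_zero_eq_bind f g _ _ r (fun i h => ?_) ?_ fun i h => ?_
  · rw [liftRen_val, dif_pos h]
    congr 2
    ext
    simp [copyRen_val, h]
  · simp [liftRen_val]
  · congr 2
    ext
    simp [copyRen_val]

theorem RenPreoperad.bind_assoc (P : RenPreoperad) {n : ℕ} (f g : P.C (n + 1)) (h : P.C n) :
    P.bind f (P.bind g h) = P.bind (P.bind (P.ren f (liftRen Fin.castSucc)) g) h := by
  let r : Ren (n + (n + n)) n := fun i =>
    ⟨if i.val < n then i.val else if i.val < n + n then i.val - n else i.val - (n + n),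
      by split_ifs <;> omega⟩
  let r₁ : Ren (n + n + n) n := fun i =>
    ⟨if i.val < n then i.val else if i.val < n + n then i.val - n else i.val - (n + n),
      by split_ifs <;> omega⟩
  let r₂ : Ren (n + n + 1) (n + 1) := fun i =>
    ⟨if i.val < n then i.val else i.val - n, by split_ifs <;> omega⟩
  let r₃ : Ren (n + (n + 1)) (n + 1) := fun i =>
    ⟨if i.val < n then i.val else i.val - n, by split_ifs <;> omega⟩
  have h₁ := P.ren_subst_zero_eq_bind f (P.subst n 0 g h) r (idRen _) (copyRen n)
    (fun i h => by simp [idRen, r, h]) rfl (fun i h => by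
      have h' : i < n + n := h
      simp only [copyRen_val, r]
      split_ifs <;> omega)
  have key := P.assoc (m₁ := n) (m₂ := 0) (n₁ := n) (n₂ := 0) f g h
  rw [acast_eq_ren P, acast_eq_ren P] at key
  have h₂ := congrArg (fun x => P.ren x r₁) key
  erw [P.ren_subst_zero_eq_bind _ h r₁ r₂ (idRen n) (fun i h => by
      simp only [r₁, r₂]; split_ifs <;> omega)
    (by simp [r₂]) (fun i h => by
      simp only [r₁, idRen]; split_ifs <;> omega)] at h₂
  rw [P.ren_ren, P.ren_ren] at h₂
  have h₃ := P.ren_subst_zero_eq_bind f g r₃ (liftRen Fin.castSucc) (idRen _)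
    (fun i h => by simp [liftRen_val, r₃, h]) (by simp [liftRen_val])
    (fun i h => by simp [idRen, r₃])
  rw [P.ren_id] at h₁ h₃ h₂
  rw [← h₃]
  exact h₁.symm.trans h₂.symm

theorem RenPreoperad.bind_var (P : RenPreoperad) {n : ℕ} (g : P.C n) :
    P.bind (P.ren P.one (fun _ => Fin.last n)) g = g := by
  have h := P.ren_subst_zero_eq_bind (n := 0) P.one g (fun i => Fin.cast (Nat.zero_add n) i)
    (fun _ => Fin.last n) (idRen n) (fun i h => absurd h (Nat.not_lt_zero i)) rfl
    (fun i h => by simp [idRen])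
  rw [P.ren_id] at h
  rw [← h, P.left_unit, acast_eq_ren P, P.ren_ren]
  exact P.ren_of_forall_eq _ _ fun i => rfl

theorem SymRenPreoperad.bind_comm_of_commute (P : SymRenPreoperad) {n : ℕ} {g₁ g₂ : P.C n}
    (h : P.Commute g₁ g₂) (f : P.C (n + 2)) :
    P.bind (P.bind f (P.ren g₂ Fin.castSucc)) g₁ =
      P.bind (P.bind (P.ren f (swapLast n)) (P.ren g₁ Fin.castSucc)) g₂ := by
  let r : Ren (n + n + n) n := fun i =>
    ⟨if i.val < n then i.val else if i.val < n + n then i.val - n else i.val - (n + n),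
      by split_ifs <;> omega⟩
  have key : P.subst (n + n) 0 (P.subst n 1 f g₁) g₂ = acast (C := P.C) (by omega)
      (P.subst n (0 + n + 0) (acast (C := P.C) (by omega) (P.subst (n + 1) 0 f g₂)) g₁) :=
    (h n 0 0 f).1
  rw [acast_eq_ren P.toRenPreoperad, acast_eq_ren P.toRenPreoperad] at key
  have key := congrArg (fun x : P.C (n + n + n) => P.ren x r) key
  rw [P.ren_subst_zero_eq_bind (P.subst n 1 f g₁) g₂ r
      (fun i => ⟨if i.val < n then i.val else i.val - n, by split_ifs <;> omega⟩) (idRen n)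
      (fun i h => by simp only [r]; split_ifs <;> omega) (by simp)
      (fun i h => by simp only [r, idRen]; split_ifs <;> omega),
    P.ren_ren,
    P.ren_subst_eq_bind (0 + n + 0) _ g₁ _
      (fun i => ⟨if i.val < n then i.val else if i.val = n then n else i.val - (n + 1),
        by split_ifs <;> omega⟩) (idRen n)
      (fun i h => by simp only [r, Fin.val_cast]; split_ifs; omega)
      (by simp)
      (fun i h => by simp only [r, Fin.val_cast]; split_ifs <;> omega)
      (fun i h => by simp only [r, Fin.val_cast, idRen]; split_ifs <;> omega),
    P.ren_id, P.ren_id, P.ren_ren,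
    P.ren_subst_eq_bind 1 f g₁ _ (swapLast n) Fin.castSucc
      (fun i h => by simp only [swapLast]; split_ifs <;> omega)
      (by simp [swapLast])
      (fun i h => by simp only [swapLast]; split_ifs <;> omega)
      (fun i h => by simp),
    P.ren_subst_zero_eq_bind f g₂ _ (idRen _) Fin.castSucc
      (fun i h => by simp only [idRen, Fin.val_cast]; split_ifs <;> omega)
      rfl
      (fun i h => by simp only [Fin.val_castSucc, Fin.val_cast]; split_ifs <;> omega),
    P.ren_id] at key
  exact key.symm

/-- A class of elements whose substitution commutes with that of arbitrary elements and is
natural in discarding and copying. -/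
structure SymRenPreoperad.IsValueClass (P : SymRenPreoperad) (Val : ∀ {n : ℕ}, P.C n → Prop) :
    Prop where
  ren : ∀ {m n : ℕ} {w : P.C m} (r : Ren m n), Val w → Val (P.ren w r)
  comm : ∀ {n : ℕ} (f : P.C (n + 2)) (g : P.C n) {w : P.C n}, Val w →
    P.bind (P.bind f (P.ren g Fin.castSucc)) w =
      P.bind (P.bind (P.ren f (swapLast n)) (P.ren w Fin.castSucc)) g
  discard : ∀ {n : ℕ} (f : P.C n) {w : P.C n}, Val w → P.bind (P.ren f Fin.castSucc) w = f
  copy : ∀ {n : ℕ} (f : P.C (n + 2)) {w : P.C n}, Val w →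
    P.bind (P.ren f (mergeLast n)) w = P.bind (P.bind f (P.ren w Fin.castSucc)) w

theorem CartOperad.isValueClass (V : CartOperad) :
    V.toSymRenPreoperad.IsValueClass (fun _ => True) where
  ren _ _ := trivial
  comm f g w _ := V.bind_comm_of_commute (V.central w g) f
  discard {n} f w _ := by
    have h := V.discard_nat (m₁ := n) (m₂ := 0) f w
    rw [RenPreoperad.bind, V.ren_congr f (r' := bsum (bsum (idRen n) (discardRen 1)) (idRen 0))
      (fun i => by
        have : i.val < n + 0 + 0 := i.isLt
        simp [bsum_val, idRen])]
    erw [h, V.ren_ren]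
    exact V.ren_of_forall_eq _ _ fun i => by
      have : i.val < n + 0 + 0 := i.isLt
      simp [bsum_val, idRen, copyRen_val]
  copy {n} f w _ := by
    have hm : mergeLast n = (bsum (bsum (idRen n) (copyRen 1)) (idRen 0) :
        Ren (n + (1 + 1) + 0) (n + 1 + 0)) := funext fun i => Fin.ext <| by
      have : i.val < n + (1 + 1) := i.isLt
      simp only [mergeLast, bsum_val, idRen, copyRen_val]
      split_ifs <;> omega
    have h := V.copy_nat (m₁ := n) (m₂ := 0) f w
    rw [acast_eq_ren V.toRenPreoperad, acast_eq_ren V.toRenPreoperad, V.ren_ren] at h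
    have h := congrArg (fun x : V.C (n + n) => V.ren x (copyRen n)) h
    rw [RenPreoperad.bind, hm]
    refine h.trans ?_
    rw [V.ren_ren,
      V.ren_subst_eq_bind (n + 0) _ w _
        (fun i => ⟨if i.val < n + 1 then i.val else i.val - (n + 1), by split_ifs <;> omega⟩)
        (idRen n)
        (fun i h => by
          simp only [copyRen_val, bsum_val, idRen, Fin.val_cast]; split_ifs <;> omega)
        (by simp)
        (fun i h => by
          simp only [copyRen_val, bsum_val, idRen, Fin.val_cast]; split_ifs <;> omega)
        (fun i h => by
          simp only [copyRen_val, bsum_val, idRen, Fin.val_cast]; split_ifs <;> omega),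
      V.ren_id, V.ren_ren,
      V.ren_subst_zero_eq_bind f w _ (idRen _) Fin.castSucc
        (fun i h => by simp only [idRen, Fin.val_cast]; split_ifs; omega)
        rfl
        (fun i h => by simp only [Fin.val_castSucc, Fin.val_cast]; split_ifs <;> omega),
      V.ren_id]

theorem SymRenPreoperad.IsValueClass.bind_bind {P : SymRenPreoperad}
    {Val : ∀ {n : ℕ}, P.C n → Prop} (hVal : P.IsValueClass Val) {n : ℕ} (f : P.C (n + 2))
    (a : P.C (n + 1)) {w : P.C n} (hw : Val w) :
    P.bind (P.bind f a) w =
      P.bind (P.bind (P.ren f (swapLast n)) (P.ren w Fin.castSucc)) (P.bind a w) := by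
  have hcomm := hVal.comm (P.ren f (liftRen (liftRen Fin.castSucc))) a
    (hVal.ren Fin.castSucc hw)
  have hcopy := hVal.copy (P.bind (P.ren f (liftRen (liftRen Fin.castSucc)))
    (P.ren a Fin.castSucc)) hw
  rw [P.bind_assoc, P.ren_bind, P.ren_ren, P.ren_ren]
  rw [P.ren_ren, P.ren_ren] at hcomm
  rw [hcomm, P.ren_bind, P.ren_ren, P.ren_ren, P.ren_of_forall_eq, P.ren_of_forall_eq] at hcopy
  · rw [hcopy]
    congr 3
    · refine P.ren_congr _ fun i => ?_
      simp only [liftRen_val, swapLast, Fin.val_castSucc]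
      split_ifs <;> omega
    · refine P.ren_congr _ fun i => ?_
      simp [liftRen_val]
  · intro i
    simp only [mergeLast, Fin.val_castSucc]
    omega
  · intro i
    simp only [liftRen_val, mergeLast, Fin.val_castSucc]
    split_ifs <;> omega

/-- Simultaneous substitution of a family of elements for the last variables. -/
def RenPreoperad.act (P : RenPreoperad) {N : ℕ} :
    ∀ {n : ℕ}, P.C (N + n) → (Fin n → P.C N) → P.C N
  | 0, f, _ => f
  | n + 1, f, g => P.act (n := n) (P.bind (n := N + n) f (P.ren (g (Fin.last n)) (Fin.castAdd n)))
      (fun i => g i.castSucc)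

/-- The renaming acting as `r` on the first block and as the identity on the second. -/
def renAdd {N M : ℕ} (r : Ren N M) (n : ℕ) : Ren (N + n) (M + n) := bsum r (idRen n)

theorem renAdd_val {N M : ℕ} (r : Ren N M) (n : ℕ) (i : Fin (N + n)) :
    (renAdd r n i).val = if h : i.val < N then (r ⟨i.val, h⟩).val else i.val - N + M := by
  simp only [renAdd, bsum_val, idRen]
  split_ifs <;> omega

theorem RenPreoperad.ren_act (P : RenPreoperad) {N M : ℕ} (r : Ren N M) :
    ∀ {n : ℕ} (f : P.C (N + n)) (g : Fin n → P.C N),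
      P.ren (P.act f g) r = P.act (P.ren f (renAdd r n)) (fun i => P.ren (g i) r)
  | 0, f, _ => P.ren_congr f fun i => by
      have : i.val < N := i.isLt
      simp [renAdd_val, this]
  | n + 1, f, g => by
      rw [RenPreoperad.act, RenPreoperad.act, P.ren_act r (n := n), P.ren_bind, P.ren_ren,
        P.ren_ren]
      congr 2
      · refine P.ren_congr _ fun i => ?_
        simp only [liftRen_val, renAdd_val]
        split_ifs <;> omega
      · refine P.ren_congr _ fun i => ?_
        simp [renAdd_val]

/-- The renaming moving the variable `N` of `N + 1 + n` to the last position. -/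
def moveLast (N n : ℕ) : Ren (N + 1 + n) (N + n + 1) := fun i =>
  ⟨if i.val < N then i.val else if i.val = N then N + n else i.val - 1, by split_ifs <;> omega⟩

theorem SymRenPreoperad.IsValueClass.bind_act {P : SymRenPreoperad}
    {Val : ∀ {n : ℕ}, P.C n → Prop} (hVal : P.IsValueClass Val) {N : ℕ} {w : P.C N}
    (hw : Val w) :
    ∀ {n : ℕ} (f : P.C (N + 1 + n)) (g : Fin n → P.C (N + 1)),
      P.bind (P.act f g) w =
        P.act (P.bind (P.ren f (moveLast N n)) (P.ren w (Fin.castAdd n)))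
          (fun i => P.bind (g i) w)
  | 0, f, _ => by
      rw [RenPreoperad.act, RenPreoperad.act, P.ren_of_forall_eq, P.ren_of_forall_eq]
      · exact fun i => rfl
      · intro i
        have : i.val < N + 1 := i.isLt
        simp only [moveLast]
        split_ifs <;> omega
  | n + 1, f, g => by
      rw [RenPreoperad.act, RenPreoperad.act, hVal.bind_act hw (n := n), P.ren_bind,
        hVal.bind_bind _ _ (hVal.ren _ hw), P.ren_ren, P.ren_ren, P.ren_ren, P.ren_bind]
      congr 3
      · refine P.ren_congr _ fun i => ?_
        simp only [liftRen_val, moveLast, swapLast]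
        split_ifs <;> omega
      · refine P.ren_congr _ fun i => ?_
        simp only [liftRen_val, moveLast, Fin.val_castAdd]
        split_ifs <;> omega

theorem finSumCases_succ_val {N n : ℕ} (i : Fin (finSum (fun _ : Fin (n + 1) => N))) :
    (finSumCases (fun _ : Fin (n + 1) => N) (fun _ a => a) i).val =
      if h : i.val < finSum (fun _ : Fin n => N) then
        (finSumCases (fun _ : Fin n => N) (fun _ a => a) ⟨i.val, h⟩).val
      else i.val - finSum (fun _ : Fin n => N) := by
  revert i
  show ∀ i : Fin (finSum (fun _ : Fin n => N) + N), _
  intro i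
  refine Fin.addCases (fun a => ?_) (fun b => ?_) i
  · exact (congrArg Fin.val (Fin.addCases_left (motive := fun _ => Fin N) a)).trans (by simp)
  · exact (congrArg Fin.val (Fin.addCases_right (motive := fun _ => Fin N) b)).trans (by simp)

theorem SymRenPreoperad.ren_psubAux_eq_act (P : SymRenPreoperad) {N : ℕ} :
    ∀ {n t : ℕ} (f : P.C (n + t)) (g : Fin n → P.C N)
      (r : Ren (finSum (fun _ : Fin n => N) + t) N) (r' : Ren (n + t) (N + n)),
      (∀ x (i : Fin (finSum (fun _ : Fin n => N))), x.val = i.val → (r x).val =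
        (finSumCases (fun _ : Fin n => N) (fun _ a => a) i).val) →
      (∀ x, x.val < n → (r' x).val = N + x.val) →
      (∀ x y, n ≤ x.val → y.val + n = x.val + finSum (fun _ : Fin n => N) →
        (r' x).val = (r y).val) →
      P.ren (P.psubAux (fun _ => N) t f g) r = P.act (P.ren f r') g
  | 0, t, f, g, r, r', h₁, h₂, h₃ =>
      P.ren_congr f fun i => (h₃ i i (Nat.zero_le _) rfl).symm
  | n + 1, t, f, g, r, r', h₁, h₂, h₃ => by
      have hfs : finSum (fun _ : Fin (n + 1) => N) = finSum (fun _ : Fin n => N) + N := rfl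
      let r'' : Ren (n + (N + t)) (N + n) := fun i =>
        if h : i.val < n then ⟨N + i.val, by omega⟩
        else if h' : i.val < n + N then ⟨i.val - n, by omega⟩
        else Fin.castAdd n
          (r ⟨i.val - n - N + finSum (fun _ : Fin (n + 1) => N), by omega⟩)
      have e₁ : ∀ i, i.val < n → (r'' i).val = N + i.val := by
        intro i h
        simp only [r'', dif_pos h]
      have e₂ : ∀ i, n ≤ i.val → i.val < n + N → (r'' i).val = i.val - n := by
        intro i h h'
        simp only [r'', dif_neg (Nat.not_lt.2 h), dif_pos h']
      have e₃ : ∀ i y, n + N ≤ i.val →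
          y.val + n + N = i.val + finSum (fun _ : Fin (n + 1) => N) →
          (r'' i).val = (r y).val := by
        intro i y h h'
        simp only [r'', dif_neg (show ¬ i.val < n by omega),
          dif_neg (show ¬ i.val < n + N by omega), Fin.val_castAdd]
        congr 2
        ext
        dsimp only
        omega
      rw [Preoperad.psubAux, acast_eq_ren P.toRenPreoperad, acast_eq_ren P.toRenPreoperad,
        P.ren_ren, P.ren_psubAux_eq_act (n := n) _ _ _ r'', RenPreoperad.act, P.ren_ren,
        P.ren_subst_eq_bind t f (g (Fin.last n)) _ r' (Fin.castAdd n)]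
      · intro i h
        rw [h₂ _ (by dsimp only; omega), e₁ _ (by simpa using h)]
        simp
      · rw [h₂ _ (by simp)]
        rfl
      · intro i h
        rw [e₃ _ ⟨finSum (fun _ : Fin (n + 1) => N) + i, by omega⟩]
        · exact h₃ _ _ (by simp) (by dsimp only; omega)
        · simp
        · simp
          omega
      · intro i h
        rw [e₂ _ (by simp) (by simpa using h)]
        simp
      · intro x i hx
        have hi := finSumCases_succ_val (N := N) (n := n) ⟨i.val, by omega⟩
        rw [dif_pos i.isLt] at hi
        exact (h₁ _ ⟨i.val, by omega⟩ hx).trans hi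
      · exact e₁
      · intro x y hx hy
        by_cases hxN : x.val < n + N
        · have hi := finSumCases_succ_val (N := N) (n := n) ⟨y.val, by omega⟩
          rw [dif_neg (by dsimp only; omega)] at hi
          rw [e₂ _ hx hxN, h₁ _ ⟨y.val, by omega⟩ rfl, hi]
          dsimp only
          omega
        · refine e₃ _ _ (by omega) ?_
          simp only [Fin.val_cast]
          omega

theorem SymRenPreoperad.ren_psub_eq_act (P : SymRenPreoperad) {N n : ℕ} (f : P.C n)
    (g : Fin n → P.C N) :
    P.ren (P.psub (fun _ => N) f g) (finSumCases (fun _ : Fin n => N) (fun _ a => a)) =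
      P.act (P.ren f (Fin.natAdd N)) g :=
  P.ren_psubAux_eq_act (t := 0) f g _ _
    (fun x i h => by rw [show x = i from Fin.ext h])
    (fun x _ => rfl)
    (fun x y h _ => absurd x.isLt (by omega))

theorem RenPreoperad.ren_act_natAdd (P : RenPreoperad) {N M n : ℕ} (f : P.C n)
    (g : Fin n → P.C N) (r : Ren N M) :
    P.ren (P.act (P.ren f (Fin.natAdd N)) g) r =
      P.act (P.ren f (Fin.natAdd M)) (fun i => P.ren (g i) r) := by
  rw [P.ren_act, P.ren_ren]
  congr 1
  refine P.ren_congr _ fun i => ?_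
  simp [renAdd_val]
  omega

theorem SymRenPreoperad.IsValueClass.bind_act_natAdd {P : SymRenPreoperad}
    {Val : ∀ {n : ℕ}, P.C n → Prop} (hVal : P.IsValueClass Val) {N n : ℕ} {w : P.C N}
    (hw : Val w) (f : P.C n) (g : Fin n → P.C (N + 1)) :
    P.bind (P.act (P.ren f (Fin.natAdd (N + 1))) g) w =
      P.act (P.ren f (Fin.natAdd N)) (fun i => P.bind (g i) w) := by
  rw [hVal.bind_act hw, P.ren_ren]
  congr 1
  rw [← hVal.discard (P.ren f (Fin.natAdd N)) (hVal.ren (Fin.castAdd n) hw), P.ren_ren]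
  congr 1
  refine P.ren_congr _ fun i => ?_
  simp only [moveLast, Fin.val_natAdd, Fin.val_castSucc]
  split_ifs <;> omega

theorem RenPreoperadHom.map_bind {P Q : RenPreoperad} (F : RenPreoperadHom P Q) {n : ℕ}
    (f : P.C (n + 1)) (g : P.C n) : F.map (P.bind f g) = Q.bind (F.map f) (F.map g) := by
  rw [RenPreoperad.bind, F.map_ren]
  exact congrArg (fun x => Q.ren x (copyRen n)) (F.map_subst (n₂ := 0) f g)

/-- The application of a value to a fresh last variable. -/
def WCFreydOperad.applyLast (O : WCFreydOperad) {n : ℕ} (v : O.V.C n) : O.C.C (n + 1) :=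
  O.C.bind (O.C.ren O.app (fun i => if i.val = 0 then Fin.last (n + 1) else (Fin.last n).castSucc))
    (O.C.ren (O.I.map v) Fin.castSucc)

theorem WCFreydOperad.ren_subst_app (O : WCFreydOperad) {n : ℕ} (v : O.V.C n)
    (h : 0 + n + 1 = n + 1) :
    O.C.ren (O.C.subst 0 1 O.app (O.I.map v)) (Fin.cast h) = O.applyLast v := by
  refine O.C.ren_subst_eq_bind 1 O.app (O.I.map v) _ _ _ (fun i h => absurd h (Nat.not_lt_zero i))
    rfl (fun i h => ?_) (fun i h => ?_)
  · simp; omega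
  · simp

theorem WCFreydOperad.applyLast_abs (O : WCFreydOperad) {n : ℕ} (f : O.C.C (n + 1)) :
    O.applyLast (O.abs f) = f := by
  rw [← O.ren_subst_app _ (by omega), O.beta, acast_eq_ren O.C.toRenPreoperad, O.C.ren_ren]
  exact O.C.ren_of_forall_eq _ _ fun i => rfl

theorem WCFreydOperad.abs_acast (O : WCFreydOperad) {m n : ℕ} (h : m = n)
    (f : O.C.C (m + 1)) :
    O.abs (acast (C := O.C.C) (congrArg (· + 1) h) f) = acast (C := O.V.C) h (O.abs f) := by
  subst h
  rfl

theorem WCFreydOperad.abs_applyLast (O : WCFreydOperad) {n : ℕ} (v : O.V.C n) :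
    O.abs (O.applyLast v) = O.V.bind (O.V.ren (O.abs (n := 1) O.app) (fun _ => Fin.last n)) v := by
  have h := O.abs_subst (m₁ := 0) (m₂ := 0) O.app v
  have h' := congrArg (acast (C := O.V.C) (show 0 + n + 0 = n by omega)) h
  rw [← O.abs_acast (show 0 + n + 0 = n by omega), acast_eq_ren O.C.toRenPreoperad,
    acast_eq_ren O.C.toRenPreoperad, O.C.ren_ren, acast_eq_ren O.V.toRenPreoperad,
    O.V.ren_subst_zero_eq_bind _ v _ (fun _ => Fin.last n) (idRen n)
      (fun i h => absurd h (Nat.not_lt_zero i)) rfl (fun i h => by simp [idRen]),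
    O.V.ren_id] at h'
  rw [← O.ren_subst_app _ (by omega)]
  exact h'

theorem WCFreydOperad.ren_applyLast (O : WCFreydOperad) {m n : ℕ} (v : O.V.C m) (r : Ren m n) :
    O.C.ren (O.applyLast v) (liftRen r) = O.applyLast (O.V.ren v r) := by
  rw [applyLast, O.C.ren_bind, applyLast, O.I.map_ren, O.C.ren_ren, O.C.ren_ren, O.C.ren_ren]
  congr 1
  · refine O.C.ren_congr _ fun i => ?_
    split_ifs <;> simp [liftRen_val]
  · refine O.C.ren_congr _ fun i => ?_
    simp [liftRen_val]

theorem WCFreydOperad.abs_ren (O : WCFreydOperad) {m n : ℕ} (f : O.C.C (m + 1)) (r : Ren m n) :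
    O.abs (O.C.ren f (liftRen r)) = O.V.ren (O.abs f) r := by
  have h := O.abs_applyLast (O.abs f)
  rw [O.applyLast_abs] at h
  rw [← O.applyLast_abs f, O.ren_applyLast, O.abs_applyLast, O.applyLast_abs]
  conv_rhs => rw [h, O.V.ren_bind, O.V.ren_ren]
  congr 1
  refine O.V.ren_congr _ fun i => ?_
  simp [liftRen_val]

theorem WCFreydOperad.bind_ren_castSucc (O : WCFreydOperad) {n : ℕ} (f : O.C.C n) (v : O.V.C n) :
    O.C.bind (O.C.ren f Fin.castSucc) (O.I.map v) = f := by
  have h := O.C.bind_comm_of_commute (O.I_central v f)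
    (O.I.map (O.V.ren O.V.one (fun _ => Fin.last (n + 1))))
  rw [← O.I.map_ren, ← O.I.map_ren, ← O.I.map_bind, O.V.ren_ren] at h
  have h' := O.V.isValueClass.discard (O.V.ren O.V.one (fun _ => Fin.last n))
    (w := O.V.ren v Fin.castSucc) trivial
  rw [O.V.ren_ren] at h'
  rw [O.V.ren_congr (r := fun _ => swapLast n (Fin.last (n + 1)))
    (r' := fun _ => (Fin.last n).castSucc) _ (fun i => by simp [swapLast]), h',
    O.I.map_ren, O.I.map_ren, O.I.map_one, O.C.bind_var, O.C.bind_var] at h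
  exact h

theorem WCFreydOperad.ren_castSucc_injective (O : WCFreydOperad) {n : ℕ} {f g : O.C.C n}
    (h : O.C.ren f Fin.castSucc = O.C.ren g Fin.castSucc) : f = g := by
  let v : O.V.C n := O.abs (O.C.ren O.C.one (fun _ => Fin.last n))
  rw [← O.bind_ren_castSucc f v, h, O.bind_ren_castSucc]

/-- The application element with its function in the last variable and its argument in the
variable `k`. -/
def WCFreydOperad.appAt (O : WCFreydOperad) {m : ℕ} (k : Fin m) : O.C.C (m + 1) :=
  O.C.ren O.app (fun i => if i.val = 0 then Fin.last m else k.castSucc)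

theorem WCFreydOperad.ren_bind_appAt (O : WCFreydOperad) {m n : ℕ} (k : Fin m) (v : O.V.C m)
    (r : Ren m n) : O.C.ren (O.C.bind (O.appAt k) (O.I.map v)) r =
      O.C.bind (O.appAt (r k)) (O.I.map (O.V.ren v r)) := by
  rw [O.C.ren_bind, appAt, O.C.ren_ren, O.I.map_ren]
  congr 1
  refine O.C.ren_congr _ fun i => ?_
  split_ifs <;> simp [liftRen_val]

theorem WCFreydOperad.bind_bind_appAt (O : WCFreydOperad) {m : ℕ} (k : Fin m)
    (v : O.V.C (m + 1)) (w : O.V.C m) :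
    O.C.bind (O.C.bind (O.appAt k.castSucc) (O.I.map v)) (O.I.map w) =
      O.C.bind (O.appAt k) (O.I.map (O.V.bind v w)) := by
  rw [O.I.map_bind, O.C.bind_assoc, appAt, appAt, O.C.ren_ren]
  congr 2
  refine O.C.ren_congr _ fun i => ?_
  split_ifs <;> simp [liftRen_val]

theorem WCFreydOperad.exists_bind_appAt_eq_ren (O : WCFreydOperad) {m : ℕ} (f : O.C.C m)
    (r : Ren m (m + 1)) (k : Fin (m + 1)) :
    ∃ v, O.C.bind (O.appAt k) (O.I.map v) = O.C.ren f r := by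
  let q : Ren (m + 1) (m + 1) := fun i => if h : i.val < m then r ⟨i.val, h⟩ else k
  refine ⟨O.V.ren (O.abs (O.C.ren f Fin.castSucc)) r, ?_⟩
  have h := congrArg (fun x => O.C.ren x q) (O.applyLast_abs (O.C.ren f Fin.castSucc))
  simp only [applyLast, O.C.ren_bind, O.C.ren_ren] at h
  have hq : (fun i : Fin m => q i.castSucc) = r := by
    funext i
    simp [q]
  rw [hq] at h
  rw [appAt, O.I.map_ren, ← h]
  congr 1
  refine O.C.ren_congr _ fun i => ?_
  split_ifs <;> simp [liftRen_val, q]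

theorem WCFreydOperad.bind_ren_mergeLast (O : WCFreydOperad) {n : ℕ} (f : O.C.C (n + 2))
    (v : O.V.C n) : O.C.bind (O.C.ren f (mergeLast n)) (O.I.map v) =
      O.C.bind (O.C.bind f (O.C.ren (O.I.map v) Fin.castSucc)) (O.I.map v) := by
  apply O.ren_castSucc_injective
  let k : Fin (n + 1) := Fin.last n
  obtain ⟨a, ha⟩ := O.exists_bind_appAt_eq_ren f (liftRen (liftRen Fin.castSucc))
    k.castSucc.castSucc
  have hcopy := O.V.isValueClass.copy a (w := O.V.ren v Fin.castSucc) trivial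
  have hl : O.C.ren (O.C.ren f (liftRen (liftRen Fin.castSucc))) (mergeLast (n + 1)) =
      O.C.ren (O.C.ren f (mergeLast n)) (liftRen Fin.castSucc) := by
    rw [O.C.ren_ren, O.C.ren_ren]
    refine O.C.ren_congr _ fun i => ?_
    simp only [liftRen_val, mergeLast, Fin.val_castSucc]
    split_ifs <;> omega
  have hm : mergeLast (n + 1) k.castSucc.castSucc = k.castSucc := by
    ext
    simp [mergeLast, k]
  have hv : O.C.ren (O.C.ren (O.I.map v) Fin.castSucc) (liftRen Fin.castSucc) =
      O.I.map (O.V.ren (O.V.ren v Fin.castSucc) Fin.castSucc) := by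
    rw [O.I.map_ren, O.I.map_ren, O.C.ren_ren, O.C.ren_ren]
    refine O.C.ren_congr _ fun i => ?_
    simp [liftRen_val]
  rw [O.C.ren_bind, O.C.ren_bind, O.C.ren_bind, hv, ← hl, ← ha, O.ren_bind_appAt, hm,
    ← O.I.map_ren, O.bind_bind_appAt, O.bind_bind_appAt, O.bind_bind_appAt, hcopy]

theorem WCFreydOperad.isValueClass (O : WCFreydOperad) :
    O.C.IsValueClass (fun {_} c => ∃ v, O.I.map v = c) where
  ren r := by
    rintro ⟨v, rfl⟩
    exact ⟨O.V.ren v r, O.I.map_ren v r⟩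
  comm f g := by
    rintro _ ⟨v, rfl⟩
    exact O.C.bind_comm_of_commute (O.I_central v g) f
  discard f := by
    rintro _ ⟨v, rfl⟩
    exact O.bind_ren_castSucc f v
  copy f := by
    rintro _ ⟨v, rfl⟩
    exact O.bind_ren_mergeLast f v

theorem WCFreydOperad.abs_bind (O : WCFreydOperad) {n : ℕ} (f : O.C.C (n + 2)) (w : O.V.C n) :
    O.abs (O.C.bind (O.C.ren f (swapLast n)) (O.C.ren (O.I.map w) Fin.castSucc)) =
      O.V.bind (O.abs f) w := by
  have h : O.C.bind (O.C.ren f (swapLast n)) (O.C.ren (O.I.map w) Fin.castSucc) =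
      O.applyLast (O.V.bind (O.abs f) w) := by
    conv_lhs => rw [← O.applyLast_abs f]
    rw [applyLast, applyLast, O.I.map_bind, O.C.ren_bind, O.C.ren_bind, O.C.bind_assoc,
      O.C.ren_ren, O.C.ren_ren, O.C.ren_ren]
    congr 2
    · refine O.C.ren_congr _ fun i => ?_
      split_ifs <;> simp [liftRen_val, swapLast]
    · refine O.C.ren_congr _ fun i => ?_
      simp only [liftRen_val, swapLast, Fin.val_castSucc]
      split_ifs <;> omega
  have hf := O.abs_applyLast (O.abs f)
  rw [O.applyLast_abs] at hf
  rw [h, O.abs_applyLast]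
  conv_rhs => rw [hf]
  rw [O.V.bind_assoc, O.V.ren_ren]
  congr 2
  refine O.V.ren_congr _ fun i => ?_
  simp [liftRen_val]

section Interpretation

variable {Sg : Sig} (S : CLCStructure Sg)

theorem interpV_func {n : ℕ} (f : Sg.Func) (args : Fin (Sg.fArity f) → DVal Sg n) :
    interpV S (.func f args) =
      S.O.V.act (S.O.V.ren (S.Ff f) (Fin.natAdd n)) (fun i => interpV S (args i)) := by
  rw [interpV, ← S.O.V.ren_psub_eq_act]

theorem interpC_proc {n : ℕ} (p : Sg.Proc) (args : Fin (Sg.pArity p) → DVal Sg n) :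
    interpC S (.proc p args) =
      S.O.C.act (S.O.C.ren (S.Pp p) (Fin.natAdd n))
        (fun i => S.O.I.map (interpV S (args i))) := by
  rw [interpC, ← S.O.C.ren_psub_eq_act]

theorem interpC_app {n : ℕ} (V₁ V₂ : DVal Sg n) :
    interpC S (.app V₁ V₂) =
      S.O.C.act (S.O.C.ren S.O.app (Fin.natAdd n))
        (fun i : Fin 2 => S.O.I.map (interpV S (Fin.cases V₁ (fun _ => V₂) i))) := by
  rw [interpC, ← S.O.C.ren_psub_eq_act]
  congr 2
  funext i
  refine Fin.cases rfl (fun _ => rfl) i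

theorem interpC_letin {n : ℕ} (M₁ : DCmp Sg n) (M₂ : DCmp Sg (n + 1)) :
    interpC S (.letin M₁ M₂) = S.O.C.bind (interpC S M₂) (interpC S M₁) := by
  rw [interpC, RenPreoperad.bind]

mutual
theorem interpV_renameV : ∀ {m n : ℕ} (V : DVal Sg m) (r : Ren m n),
    interpV S (renameV V r) = S.O.V.ren (interpV S V) r
  | _, _, .var i, r => by
      rw [renameV, interpV, interpV, S.O.V.ren_ren]
  | _, _, .func f args, r => by
      rw [renameV, interpV_func, interpV_func, S.O.V.ren_act_natAdd]
      congr 1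
      funext i
      exact interpV_renameV (args i) r
  | _, _, .lam M, r => by
      rw [renameV, interpV, interpV, interpC_renameC M (liftRen r), S.O.abs_ren]

theorem interpC_renameC : ∀ {m n : ℕ} (M : DCmp Sg m) (r : Ren m n),
    interpC S (renameC M r) = S.O.C.ren (interpC S M) r
  | _, _, .ret W, r => by
      rw [renameC, interpC, interpC, interpV_renameV W r, S.O.I.map_ren]
  | _, _, .letin M₁ M₂, r => by
      rw [renameC, interpC_letin, interpC_letin, interpC_renameC M₁ r,
        interpC_renameC M₂ (liftRen r), S.O.C.ren_bind]
  | _, _, .proc p args, r => by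
      rw [renameC, interpC_proc, interpC_proc, S.O.C.ren_act_natAdd]
      congr 1
      funext i
      rw [interpV_renameV (args i) r, S.O.I.map_ren]
  | _, _, .app V₁ V₂, r => by
      rw [renameC, interpC_app, interpC_app, S.O.C.ren_act_natAdd]
      congr 1
      funext i
      refine Fin.cases ?_ (fun _ => ?_) i
      · exact (congrArg _ (interpV_renameV V₁ r)).trans (S.O.I.map_ren _ _)
      · exact (congrArg _ (interpV_renameV V₂ r)).trans (S.O.I.map_ren _ _)
end

theorem interpV_liftSub {m n : ℕ} {σ : Fin m → DVal Sg n} {ρ : Ren m (n + 1)} {w : S.O.V.C n}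
    (h : ∀ i, interpV S (σ i) = S.O.V.bind (S.O.V.ren S.O.V.one (fun _ => ρ i)) w)
    (i : Fin (m + 1)) :
    interpV S (liftSub σ i) =
      S.O.V.bind (S.O.V.ren S.O.V.one (fun _ => swapLast n (liftRen ρ i)))
        (S.O.V.ren w Fin.castSucc) := by
  refine Fin.lastCases ?_ (fun j => ?_) i
  · have hd := S.O.V.isValueClass.discard (S.O.V.ren S.O.V.one (fun _ => Fin.last n))
      (w := S.O.V.ren w Fin.castSucc) trivial
    rw [S.O.V.ren_ren] at hd
    rw [liftSub, Fin.lastCases_last, interpV, ← hd]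
    congr 1
    refine S.O.V.ren_congr _ fun i => ?_
    simp [swapLast, liftRen_val]
  · rw [liftSub, Fin.lastCases_castSucc, interpV_renameV, h, S.O.V.ren_bind, S.O.V.ren_ren]
    congr 1
    refine S.O.V.ren_congr _ fun i => ?_
    simp [swapLast, liftRen_val]
    split_ifs <;> omega

theorem ren_liftRen_swapLast {P : RenPreoperad} {m n : ℕ} (f : P.C (m + 1)) (ρ : Ren m (n + 1)) :
    P.ren f (fun i => swapLast n (liftRen ρ i)) = P.ren (P.ren f (liftRen ρ)) (swapLast n) := by
  rw [P.ren_ren]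

mutual
theorem interpV_substV : ∀ {m n : ℕ} (V : DVal Sg m) (σ : Fin m → DVal Sg n) (ρ : Ren m (n + 1))
    (w : S.O.V.C n),
    (∀ i, interpV S (σ i) = S.O.V.bind (S.O.V.ren S.O.V.one (fun _ => ρ i)) w) →
    interpV S (substV V σ) = S.O.V.bind (S.O.V.ren (interpV S V) ρ) w
  | _, _, .var i, σ, ρ, w, h => by
      rw [substV, interpV, h, S.O.V.ren_ren]
  | _, _, .func f args, σ, ρ, w, h => by
      rw [substV, interpV_func, interpV_func, S.O.V.ren_act_natAdd,
        S.O.V.isValueClass.bind_act_natAdd trivial]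
      congr 1
      funext i
      exact interpV_substV (args i) σ ρ w h
  | _, _, .lam M, σ, ρ, w, h => by
      rw [substV, interpV, interpV,
        interpC_substC M (liftSub σ) _ (S.O.V.ren w Fin.castSucc) (interpV_liftSub S h),
        ren_liftRen_swapLast, S.O.I.map_ren, S.O.abs_bind, S.O.abs_ren]

theorem interpC_substC : ∀ {m n : ℕ} (M : DCmp Sg m) (σ : Fin m → DVal Sg n) (ρ : Ren m (n + 1))
    (w : S.O.V.C n),
    (∀ i, interpV S (σ i) = S.O.V.bind (S.O.V.ren S.O.V.one (fun _ => ρ i)) w) →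
    interpC S (substC M σ) = S.O.C.bind (S.O.C.ren (interpC S M) ρ) (S.O.I.map w)
  | _, _, .ret W, σ, ρ, w, h => by
      rw [substC, interpC, interpC, interpV_substV W σ ρ w h, S.O.I.map_bind, S.O.I.map_ren]
  | _, _, .letin M₁ M₂, σ, ρ, w, h => by
      rw [substC, interpC_letin, interpC_letin, interpC_substC M₁ σ ρ w h,
        interpC_substC M₂ (liftSub σ) _ (S.O.V.ren w Fin.castSucc) (interpV_liftSub S h),
        ren_liftRen_swapLast, S.O.I.map_ren, S.O.C.ren_bind,
        S.O.isValueClass.bind_bind _ _ ⟨w, rfl⟩]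
  | _, _, .proc p args, σ, ρ, w, h => by
      rw [substC, interpC_proc, interpC_proc, S.O.C.ren_act_natAdd,
        S.O.isValueClass.bind_act_natAdd ⟨w, rfl⟩]
      congr 1
      funext i
      rw [interpV_substV (args i) σ ρ w h, S.O.I.map_bind, S.O.I.map_ren]
  | _, _, .app V₁ V₂, σ, ρ, w, h => by
      rw [substC, interpC_app, interpC_app, S.O.C.ren_act_natAdd,
        S.O.isValueClass.bind_act_natAdd ⟨w, rfl⟩]
      congr 1
      funext i
      refine Fin.cases ?_ (fun _ => ?_) i
      · simp only [Fin.cases_zero]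
        rw [interpV_substV V₁ σ ρ w h, S.O.I.map_bind, S.O.I.map_ren]
      · simp only [Fin.cases_succ]
        rw [interpV_substV V₂ σ ρ w h, S.O.I.map_bind, S.O.I.map_ren]
end

theorem interpC_substC_sub1 {n : ℕ} (M : DCmp Sg (n + 1)) (W : DVal Sg n) :
    interpC S (substC M (sub1 W)) = S.O.C.bind (interpC S M) (S.O.I.map (interpV S W)) := by
  rw [interpC_substC S M (sub1 W) (idRen (n + 1)) (interpV S W),
    S.O.C.ren_of_forall_eq _ (idRen (n + 1)) fun i => rfl]
  intro i
  refine Fin.lastCases ?_ (fun j => ?_) i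
  · rw [sub1, Fin.lastCases_last]
    exact (S.O.V.bind_var _).symm
  · have hd := S.O.V.isValueClass.discard (S.O.V.ren S.O.V.one (fun _ => j))
      (w := interpV S W) trivial
    rw [S.O.V.ren_ren] at hd
    rw [sub1, Fin.lastCases_castSucc, interpV]
    exact hd.symm

theorem interpC_app_eq_bind_applyLast {n : ℕ} (V₁ V₂ : DVal Sg n) :
    interpC S (.app V₁ V₂) =
      S.O.C.bind (S.O.applyLast (interpV S V₁)) (S.O.I.map (interpV S V₂)) := by
  have hact : interpC S (.app V₁ V₂) =
      S.O.C.bind (S.O.C.bind (S.O.C.ren S.O.app (Fin.natAdd n))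
        (S.O.C.ren (S.O.I.map (interpV S V₂)) Fin.castSucc)) (S.O.I.map (interpV S V₁)) := by
    rw [interpC_app]
    exact congrArg (S.O.C.bind _) (S.O.C.ren_of_forall_eq _ _ fun i => rfl)
  rw [hact, S.O.isValueClass.comm _ _ ⟨_, rfl⟩, WCFreydOperad.applyLast, S.O.C.ren_ren]
  congr 2
  refine S.O.C.ren_congr _ fun i => ?_
  fin_cases i <;> simp [swapLast]

theorem interpC_runit {n : ℕ} (M : DCmp Sg n) :
    interpC S (.letin M (.ret (.var (Fin.last n)))) = interpC S M := by
  rw [interpC_letin, interpC, interpV, S.O.I.map_ren, S.O.I.map_one, S.O.C.bind_var]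

theorem interpC_assoc {n : ℕ} (M₁ : DCmp Sg n) (M₂ M : DCmp Sg (n + 1)) :
    interpC S (.letin (.letin M₁ M₂) M) =
      interpC S (.letin M₁ (.letin M₂ (renameC M (midWeak n)))) := by
  simp only [interpC_letin, interpC_renameC, S.O.C.bind_assoc]
  congr 2

mutual
theorem interpV_eq_of_eqV : ∀ {n : ℕ} {V₁ V₂ : DVal Sg n}, EqV Sg V₁ V₂ →
    interpV S V₁ = interpV S V₂
  | _, _, _, .refl _ => rfl
  | _, _, _, .symm h => (interpV_eq_of_eqV h).symm
  | _, _, _, .trans h₁ h₂ => (interpV_eq_of_eqV h₁).trans (interpV_eq_of_eqV h₂)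
  | _, _, _, .func f h => by
      simp only [interpV, interpV_eq_of_eqV (h _)]
  | _, _, _, .lam h => by rw [interpV, interpV, interpC_eq_of_eqC h]

theorem interpC_eq_of_eqC : ∀ {n : ℕ} {M₁ M₂ : DCmp Sg n}, EqC Sg M₁ M₂ →
    interpC S M₁ = interpC S M₂
  | _, _, _, .refl _ => rfl
  | _, _, _, .symm h => (interpC_eq_of_eqC h).symm
  | _, _, _, .trans h₁ h₂ => (interpC_eq_of_eqC h₁).trans (interpC_eq_of_eqC h₂)
  | _, _, _, .ret h => by rw [interpC, interpC, interpV_eq_of_eqV h]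
  | _, _, _, .letin h₁ h₂ => by
      rw [interpC, interpC, interpC_eq_of_eqC h₁, interpC_eq_of_eqC h₂]
  | _, _, _, .proc p h => by
      simp only [interpC, interpV_eq_of_eqV (h _)]
  | _, _, _, .app h₁ h₂ => by
      rw [interpC, interpC, interpV_eq_of_eqV h₁, interpV_eq_of_eqV h₂]
  | _, _, _, .lunit W M => by rw [interpC_substC_sub1, interpC_letin, interpC]
  | _, _, _, .runit M => interpC_runit S M
  | _, _, _, .assoc M₁ M₂ M => interpC_assoc S M₁ M₂ M
  | _, _, _, .beta M W => by
      rw [interpC_substC_sub1, interpC_app_eq_bind_applyLast, interpV, S.O.applyLast_abs]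
end

end Interpretation

/-- **soundness.** If `Γ ⊢ t₁ ≡ t₂` is derivable in the equational theory
of λ_CLC (for well-formed terms of the same sort), then `⟦t₁⟧ = ⟦t₂⟧` in every
λ_CLC-structure. -/
theorem stmt16 {Sg : Sig} :
    (∀ {n : ℕ} (V₁ V₂ : DVal Sg n), EqV Sg V₁ V₂ →
      ∀ S : CLCStructure Sg, interpV S V₁ = interpV S V₂) ∧
    (∀ {n : ℕ} (M₁ M₂ : DCmp Sg n), EqC Sg M₁ M₂ →
      ∀ S : CLCStructure Sg, interpC S M₁ = interpC S M₂) := by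
  exact ⟨fun _ _ h S => interpV_eq_of_eqV S h, fun _ _ h S => interpC_eq_of_eqC S h⟩
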